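/- Among all 3×3 boards not equivalent to the standard board S, the board [(1 3)] maximizes the number of four-letter words shared with S: for every bijection B : Fin 3 × Fin 3 → Fin 9 that is not equivalent to S, the cardinality of W₄(B) ∩ W₄(S) is at most 376. -/

import Mathlib

/-- King-move adjacency on the cells of a 3×3 grid: two cells are adjacent if they are
distinct and their coordinates differ by at most 1 in each component. -/
def cellAdj (a b : Fin 3 × Fin 3) : Prop :=
  a ≠ b ∧ |(a.1.val : ℤ) - (b.1.val : ℤ)| ≤ 1 ∧ |(a.2.val : ℤ) - (b.2.val : ℤ)| ≤ 1

/-- `w` is a word of the board `B`: a list of letters of length at least 2 of the form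
`B c₁, …, B c_k` where the cells `c₁, …, c_k` are pairwise distinct and consecutive
cells are adjacent.  (For a bijective board this says exactly that `w` is a list of
pairwise distinct letters whose consecutive letters occupy adjacent cells.) -/
def IsWordOf {A : Type*} (B : Fin 3 × Fin 3 → A) (w : List A) : Prop :=
  2 ≤ w.length ∧
    ∃ cs : List (Fin 3 × Fin 3), cs.map B = w ∧ cs.Nodup ∧ cs.Chain' cellAdj

/-- The set `W(B)` of all words of the board `B`. -/
def Words {A : Type*} (B : Fin 3 × Fin 3 → A) : Set (List A) :=
  {w | IsWordOf B w}

/-- The set `W_k(B)` of all `k`-letter words of the board `B`. -/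
def WordsOfLen {A : Type*} (B : Fin 3 × Fin 3 → A) (k : ℕ) : Set (List A) :=
  {w | w.length = k ∧ IsWordOf B w}

/-- Rotation of the 3×3 grid by 90 degrees. -/
def rotCell (c : Fin 3 × Fin 3) : Fin 3 × Fin 3 := (c.2, 2 - c.1)

/-- Reflection of the 3×3 grid along the main diagonal. -/
def reflCell (c : Fin 3 × Fin 3) : Fin 3 × Fin 3 := (c.2, c.1)

/-- The symmetry group of the square acting on the 3×3 grid: the eight
rotations and reflections. -/
def squareSymm : Set ((Fin 3 × Fin 3) → (Fin 3 × Fin 3)) :=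
  {id, rotCell, rotCell ∘ rotCell, rotCell ∘ rotCell ∘ rotCell,
   reflCell, reflCell ∘ rotCell, reflCell ∘ rotCell ∘ rotCell,
   reflCell ∘ rotCell ∘ rotCell ∘ rotCell}

/-- Two boards are equivalent if one is obtained from the other by a symmetry
of the square. -/
def BoardEquiv {A : Type*} (B B' : Fin 3 × Fin 3 → A) : Prop :=
  ∃ σ ∈ squareSymm, B' = B ∘ σ

/-- The standard board `S`: the border cells, read clockwise from the top-left
corner, carry the letters `0,…,7` and the center cell carries the letter `8`
(letters are 0-indexed, so paper letter `i` is `i - 1 : Fin 9`). -/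
def stdBoard : Fin 3 × Fin 3 → Fin 9 := fun c =>
  ![![(0 : Fin 9), 1, 2], ![7, 8, 3], ![6, 5, 4]] c.1 c.2

/-- The board `[(1 3)]` obtained from the standard board by swapping the two upper
corner letters (paper letters 1 and 3, i.e. `0` and `2 : Fin 9`). -/
def swapBoard : Fin 3 × Fin 3 → Fin 9 :=
  (Equiv.swap (0 : Fin 9) 2) ∘ stdBoard

/-- The `9 × 9` adjacency matrix of the letters of the standard board, packed into one number:
bit `9 * i + j` is set when the letters `i` and `j` are adjacent. -/
def kingMask : ℕ := 1207485260822029187881858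

/-- Adjacency of letters on the standard board. -/
def kingAdj (i j : ℕ) : Bool :=
  Nat.beq (Nat.land (Nat.shiftRight kingMask (Nat.add (Nat.mul 9 i) j)) 1) 1

/-- The edges `(k, j)` of the standard board with `k` in `ks` and `j` either in `js` or before `k`
in `ks`. -/
def edgesFrom : List ℕ → List ℕ → List (ℕ × ℕ)
  | [], _ => []
  | k :: ks, js => (js.filter (kingAdj k)).map (fun j => (k, j)) ++ edgesFrom ks (k :: js)

/-- The order in which the search places the letters. -/
def letterOrder : List ℕ := [8, 1, 3, 5, 7, 0, 2, 4, 6]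

/-- The four-letter words of the standard board. -/
def stdPaths : List (ℕ × ℕ × ℕ × ℕ) :=
  (List.range 9).flatMap fun a => ((List.range 9).filter (kingAdj a)).flatMap fun b =>
    ((List.range 9).filter fun c => kingAdj b c && c != a).flatMap fun c =>
      ((List.range 9).filter fun d => kingAdj c d && (d != a && d != b)).map fun d => (a, b, c, d)

/-- The set of directed edges of a four-letter word, as a bit mask. -/
def pathMask (q : ℕ × ℕ × ℕ × ℕ) : ℕ :=
  2 ^ (9 * q.1 + q.2.1) ||| (2 ^ (9 * q.2.1 + q.2.2.1) ||| 2 ^ (9 * q.2.2.1 + q.2.2.2))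

/-- The two orientations of an edge, as a bit mask. -/
def edgeMask (e : ℕ × ℕ) : ℕ := 2 ^ (9 * e.1 + e.2) ||| 2 ^ (9 * e.2 + e.1)

/-- The masks in `W` that do not use the edge `e`. This is a `List.filter`, in a form that the
kernel evaluates faster. -/
def avoiding (e : ℕ × ℕ) (W : List ℕ) : List ℕ :=
  List.rec [] (fun m _ ih => cond (Nat.beq (Nat.land m (edgeMask e)) 0) (m :: ih) ih) W

/-- The masks in `W` that use no edge of `F`. -/
def avoidingAll (F : List (ℕ × ℕ)) (W : List ℕ) : List ℕ := F.foldl (fun W e => avoiding e W) W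

/-- Every choice of `n` edges of `es` has a subset whose removal leaves at most 376 masks of `W`. -/
def checkRemovals : List (ℕ × ℕ) → ℕ → List ℕ → Bool
  | _, 0, _ => false
  | [], _ + 1, _ => true
  | e :: es, n + 1, W => checkRemovals es (n + 1) W &&
      (Nat.ble (avoiding e W).length 376 || checkRemovals es n (avoiding e W))

/-- The pairs in `asg` are the graph of a symmetry of the square, acting on letters. -/
def isRingSymm (asg : List (ℕ × ℕ)) : Bool :=
  [0, 2, 4, 6].any fun r =>
    asg.all (fun e => e.2 == if e.1 = 8 then 8 else (e.1 + r) % 8) ||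
    asg.all (fun e => e.2 == if e.1 = 8 then 8 else (r + 8 - e.1) % 8)

/-- Backtracking over all ways to place the letters `ks` on the positions `avail`, given the
placement `asg` of the earlier letters and the list `F` of edges it destroys. Branches destroying
three edges are cut. -/
def search : List ℕ → List ℕ → List (ℕ × ℕ) → List (ℕ × ℕ) → Bool
  | [], _, asg, F =>
      isRingSymm asg || Nat.ble (avoidingAll F (stdPaths.map pathMask)).length 376
  | k :: ks, avail, asg, F => avail.all fun x =>
      match F ++ ((asg.filter fun e => kingAdj k e.1).filter fun e => !kingAdj x e.2).map
          (fun e => (k, e.1)) with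
      | _ :: _ :: _ :: _ => true
      | F' => search ks (avail.erase x) ((k, x) :: asg) F'

theorem checkRemovals_three :
    checkRemovals (edgesFrom letterOrder []) 3 (stdPaths.map pathMask) = true := by
  decide +kernel

theorem search_letterOrder : search letterOrder (List.range 9) [] [] = true := by
  decide +kernel

theorem avoiding_eq_filter (e : ℕ × ℕ) (W : List ℕ) :
    avoiding e W = W.filter fun m => Nat.beq (Nat.land m (edgeMask e)) 0 := by
  induction W with
  | nil => rfl
  | cons m W ih =>
    rw [List.filter_cons, ← ih]
    change cond _ _ _ = _
    rw [Bool.cond_eq_ite]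
    rfl

theorem avoidingAll_eq_filter (F : List (ℕ × ℕ)) (W : List ℕ) :
    avoidingAll F W = W.filter fun m => F.all fun e => Nat.beq (Nat.land m (edgeMask e)) 0 := by
  induction F generalizing W with
  | nil => simp [avoidingAll]
  | cons e F ih =>
    change avoidingAll F (avoiding e W) = _
    rw [ih, avoiding_eq_filter, List.filter_filter]
    simp [Bool.and_comm]

theorem exists_subset_of_checkRemovals {es : List (ℕ × ℕ)} {n : ℕ} {W : List ℕ}
    (h : checkRemovals es n W = true) {F : List (ℕ × ℕ)} (hF : F.Sublist es) (hn : F.length = n) :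
    ∃ F', F' ⊆ F ∧ (avoidingAll F' W).length ≤ 376 := by
  induction hF generalizing n W with
  | slnil => subst hn; simp [checkRemovals] at h
  | @cons F es e _ ih =>
    cases n with
    | zero => simp [checkRemovals] at h
    | succ n =>
      simp only [checkRemovals, Bool.and_eq_true] at h
      exact ih h.1 hn
  | @cons_cons F es e _ ih =>
    subst hn
    simp only [List.length_cons, checkRemovals, Bool.and_eq_true, Bool.or_eq_true,
      Nat.ble_eq] at h
    obtain h | h := h.2
    · exact ⟨[e], by simp, h⟩
    · obtain ⟨F', hsub, hle⟩ := ih h rfl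
      exact ⟨e :: F', List.cons_subset_cons e hsub, hle⟩

theorem search_sound (p : ℕ → ℕ) {ks avail js : List ℕ} {F : List (ℕ × ℕ)}
    (h : search ks avail (js.map fun j => (j, p j)) F = true)
    (havail : ∀ k ∈ ks, p k ∈ avail) (hnodup : (ks.map p).Nodup) :
    3 ≤ (F ++ (edgesFrom ks js).filter fun e => !kingAdj (p e.1) (p e.2)).length ∨
    isRingSymm ((ks.reverse ++ js).map fun j => (j, p j)) = true ∨
    (avoidingAll (F ++ (edgesFrom ks js).filter fun e => !kingAdj (p e.1) (p e.2))
      (stdPaths.map pathMask)).length ≤ 376 := by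
  induction ks generalizing avail js F with
  | nil =>
    simp only [search, Bool.or_eq_true, Nat.ble_eq] at h
    simpa [edgesFrom] using Or.inr h
  | cons k ks ih =>
    rw [search, List.all_eq_true] at h
    have hk := h (p k) (havail k (by simp))
    have hF : ((((js.map fun j => (j, p j)).filter fun e => kingAdj k e.1).filter
        fun e => !kingAdj (p k) e.2).map fun e => (k, e.1)) =
        ((js.filter (kingAdj k)).map fun j => (k, j)).filter
          fun e => !kingAdj (p e.1) (p e.2) := by
      simp [List.filter_map, Function.comp_def]
    rw [hF] at hk
    rw [edgesFrom, List.filter_append, ← List.append_assoc]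
    split at hk
    · next heq =>
      left
      rw [heq]
      simp
    · simp only [List.map_cons, List.nodup_cons, List.mem_map, not_exists, not_and] at hnodup
      have := ih (js := k :: js) hk (fun k' hk' => (List.mem_erase_of_ne
        (hnodup.1 k' hk')).2 (havail k' (by simp [hk']))) hnodup.2
      simpa using this

/-- A placement of the letters that is not a symmetry of the square destroys a set of edges whose
removal leaves at most 376 words. -/
theorem exists_destroyed_edges (p : ℕ → ℕ) (hp : ∀ k ∈ letterOrder, p k < 9)
    (hnodup : (letterOrder.map p).Nodup)
    (hsymm : isRingSymm (letterOrder.reverse.map fun j => (j, p j)) ≠ true) :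
    ∃ F : List (ℕ × ℕ),
      (∀ e ∈ F, e ∈ edgesFrom letterOrder [] ∧ kingAdj (p e.1) (p e.2) = false) ∧
      (avoidingAll F (stdPaths.map pathMask)).length ≤ 376 := by
  have hmem : ∀ e ∈ (edgesFrom letterOrder []).filter fun e => !kingAdj (p e.1) (p e.2),
      e ∈ edgesFrom letterOrder [] ∧ kingAdj (p e.1) (p e.2) = false := by
    intro e he
    simpa using List.mem_filter.1 he
  obtain h | h | h := search_sound p (js := []) (F := []) search_letterOrder
    (fun k hk => List.mem_range.2 (hp k hk)) hnodup
  · rw [List.nil_append] at h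
    obtain ⟨F, hF, hle⟩ := exists_subset_of_checkRemovals checkRemovals_three
      ((List.take_sublist 3 _).trans List.filter_sublist) (List.length_take_of_le h)
    exact ⟨F, fun e he => hmem e (List.mem_of_mem_take (hF he)), hle⟩
  · exact absurd (by simpa using h) hsymm
  · exact ⟨_, hmem, h⟩

theorem pathMask_land_edgeMask {p : ℕ → ℕ} {a b c d i j : ℕ} (ha : a < 9) (hb : b < 9) (hc : c < 9)
    (hd : d < 9) (hi : i < 9) (hj : j < 9) (hab : kingAdj (p a) (p b) = true)
    (hbc : kingAdj (p b) (p c) = true) (hcd : kingAdj (p c) (p d) = true)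
    (hij : kingAdj (p i) (p j) = false) (hji : kingAdj (p j) (p i) = false) :
    Nat.land (pathMask (a, b, c, d)) (edgeMask (i, j)) = 0 := by
  have key : ∀ {x y u v : ℕ}, x < 9 → y < 9 → u < 9 → v < 9 → kingAdj (p x) (p y) = true →
      kingAdj (p u) (p v) = false → 9 * x + y ≠ 9 * u + v := by
    intro x y u v hx hy hu hv h h' heq
    obtain rfl : x = u := by omega
    obtain rfl : y = v := by omega
    simp [h] at h'
  have h₁ := key ha hb hi hj hab hij
  have h₂ := key ha hb hj hi hab hji
  have h₃ := key hb hc hi hj hbc hij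
  have h₄ := key hb hc hj hi hbc hji
  have h₅ := key hc hd hi hj hcd hij
  have h₆ := key hc hd hj hi hcd hji
  change pathMask (a, b, c, d) &&& edgeMask (i, j) = 0
  refine Nat.eq_of_testBit_eq fun n => ?_
  simp only [pathMask, edgeMask, Nat.testBit_and, Nat.testBit_or, Nat.testBit_two_pow,
    Nat.zero_testBit]
  by_contra hne
  simp only [Bool.not_eq_false, Bool.and_eq_true, Bool.or_eq_true, decide_eq_true_eq] at hne
  omega

theorem cellAdj_iff_kingAdj : ∀ a b : Fin 3 × Fin 3,
    cellAdj a b ↔ kingAdj (stdBoard a).val (stdBoard b).val = true := by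
  unfold cellAdj
  decide +kernel

theorem stdBoard_injective : Function.Injective stdBoard := by
  unfold Function.Injective
  decide +kernel

theorem kingAdj_comm : ∀ a b : Fin 9, kingAdj a.val b.val = kingAdj b.val a.val := by
  decide +kernel

theorem lt_nine_of_mem_edgesFrom :
    ∀ e ∈ edgesFrom letterOrder [], e.1 < 9 ∧ e.2 < 9 := by
  decide +kernel

theorem exists_letters_of_isWordOf {B : Fin 3 × Fin 3 → Fin 9} {w : List (Fin 9)}
    (hw : w ∈ WordsOfLen B 4) :
    ∃ c₁ c₂ c₃ c₄, w = [B c₁, B c₂, B c₃, B c₄] ∧ [c₁, c₂, c₃, c₄].Nodup ∧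
      cellAdj c₁ c₂ ∧ cellAdj c₂ c₃ ∧ cellAdj c₃ c₄ := by
  obtain ⟨hlen, -, cs, rfl, hnodup, hchain⟩ := hw
  rw [List.length_map] at hlen
  match cs, hlen with
  | [c₁, c₂, c₃, c₄], _ =>
    refine ⟨c₁, c₂, c₃, c₄, rfl, hnodup, ?_⟩
    change List.IsChain cellAdj _ at hchain
    simpa using hchain

theorem mem_stdPaths {a b c d : Fin 9} (hw : [a, b, c, d] ∈ WordsOfLen stdBoard 4) :
    (a.val, b.val, c.val, d.val) ∈ stdPaths := by
  obtain ⟨c₁, c₂, c₃, c₄, heq, hnodup, h₁, h₂, h₃⟩ := exists_letters_of_isWordOf hw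
  have hnd : [a, b, c, d].Nodup := by
    have := hnodup.map stdBoard_injective
    rwa [heq]
  simp only [List.cons.injEq, and_true] at heq
  obtain ⟨rfl, rfl, rfl, rfl⟩ := heq
  rw [cellAdj_iff_kingAdj] at h₁ h₂ h₃
  simp only [List.nodup_cons, List.mem_cons, List.not_mem_nil, or_false, not_or, Fin.ext_iff] at hnd
  simp only [stdPaths, List.mem_flatMap, List.mem_map, List.mem_filter, List.mem_range,
    Bool.and_eq_true, bne_iff_ne]
  exact ⟨_, Fin.isLt _, _, ⟨Fin.isLt _, h₁⟩, _, ⟨Fin.isLt _, h₂, by omega⟩, _,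
    ⟨Fin.isLt _, h₃, by omega, by omega⟩, rfl⟩

theorem exists_squareSymm_rotate : ∀ r ∈ [0, 2, 4, 6], ∃ σ ∈ squareSymm, ∀ c,
    (if (stdBoard (σ c)).val = 8 then 8 else ((stdBoard (σ c)).val + r) % 8) =
      (stdBoard c).val := by
  simp only [squareSymm, Set.mem_insert_iff, Set.mem_singleton_iff, exists_eq_or_imp,
    exists_eq_left]
  decide +kernel

theorem exists_squareSymm_reflect : ∀ r ∈ [0, 2, 4, 6], ∃ σ ∈ squareSymm, ∀ c,
    (if (stdBoard (σ c)).val = 8 then 8 else (r + 8 - (stdBoard (σ c)).val) % 8) =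
      (stdBoard c).val := by
  simp only [squareSymm, Set.mem_insert_iff, Set.mem_singleton_iff, exists_eq_or_imp,
    exists_eq_left]
  decide +kernel

theorem mem_letterOrder : ∀ ℓ : Fin 9, ℓ.val ∈ letterOrder := by
  decide +kernel

theorem exists_squareSymm_of_isRingSymm {p : ℕ → ℕ}
    (h : isRingSymm (letterOrder.reverse.map fun j => (j, p j)) = true) :
    ∃ σ ∈ squareSymm, ∀ c, p (stdBoard (σ c)).val = (stdBoard c).val := by
  simp only [isRingSymm, List.any_eq_true, Bool.or_eq_true, List.all_eq_true, List.mem_map,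
    List.mem_reverse, beq_iff_eq, forall_exists_index, and_imp, forall_apply_eq_imp_iff₂] at h
  obtain ⟨r, hr, h | h⟩ := h
  · obtain ⟨σ, hσ, hc⟩ := exists_squareSymm_rotate r hr
    exact ⟨σ, hσ, fun c => (h _ (mem_letterOrder _)).trans (hc c)⟩
  · obtain ⟨σ, hσ, hc⟩ := exists_squareSymm_reflect r hr
    exact ⟨σ, hσ, fun c => (h _ (mem_letterOrder _)).trans (hc c)⟩

/-- Every 3×3 board not equivalent to the standard board shares at most 376
4-letter words with the standard board. -/
theorem common_words_max (B : Fin 3 × Fin 3 → Fin 9) (hB : Function.Bijective B)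
    (hne : ¬ BoardEquiv stdBoard B) :
    (WordsOfLen B 4 ∩ WordsOfLen stdBoard 4).ncard ≤ 376 := by
  set e := Equiv.ofBijective B hB
  let p : ℕ → ℕ := fun n => (stdBoard (e.symm (Fin.ofNat 9 n))).val
  have hpB : ∀ c, p (B c).val = (stdBoard c).val := by
    intro c
    have : e.symm (B c) = c := e.symm_apply_apply c
    simp [p, this]
  have hinj : ∀ ℓ m : Fin 9, p ℓ.val = p m.val → ℓ = m := by
    intro ℓ m h
    simpa [p, Fin.val_inj, stdBoard_injective.eq_iff] using h
  have hnodup : (letterOrder.map p).Nodup := by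
    refine List.Nodup.map_on ?_ (by decide)
    have hlt : ∀ k ∈ letterOrder, k < 9 := by decide
    intro x hx y hy hxy
    exact congrArg Fin.val (hinj ⟨x, hlt x hx⟩ ⟨y, hlt y hy⟩ hxy)
  obtain ⟨F, hF, hle⟩ := exists_destroyed_edges p (fun k _ => Fin.isLt _) hnodup fun h => by
    obtain ⟨σ, hσ, hc⟩ := exists_squareSymm_of_isRingSymm h
    exact hne ⟨σ, hσ, funext fun c => hinj _ _ ((hpB c).trans (hc c).symm)⟩
  rw [avoidingAll_eq_filter, List.filter_map, List.length_map] at hle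
  set L := stdPaths.filter _ with hL
  let word : ℕ × ℕ × ℕ × ℕ → List (Fin 9) := fun q =>
    [Fin.ofNat 9 q.1, Fin.ofNat 9 q.2.1, Fin.ofNat 9 q.2.2.1, Fin.ofNat 9 q.2.2.2]
  have hsub : WordsOfLen B 4 ∩ WordsOfLen stdBoard 4 ⊆ ((L.map word).toFinset : Set _) := by
    rintro w ⟨hwB, hwS⟩
    obtain ⟨c₁, c₂, c₃, c₄, rfl, -, h₁, h₂, h₃⟩ := exists_letters_of_isWordOf hwB
    rw [cellAdj_iff_kingAdj, ← hpB, ← hpB] at h₁ h₂ h₃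
    simp only [List.coe_toFinset, Set.mem_ofPred_eq, List.mem_map]
    refine ⟨_, List.mem_filter.2 ⟨mem_stdPaths hwS, ?_⟩, by simp [word]⟩
    rw [Function.comp_apply, List.all_eq_true]
    intro ij hij
    obtain ⟨hmem, hlost⟩ := hF ij hij
    obtain ⟨hi, hj⟩ := lt_nine_of_mem_edgesFrom ij hmem
    rw [Nat.beq_eq]
    refine pathMask_land_edgeMask (Fin.isLt _) (Fin.isLt _) (Fin.isLt _) (Fin.isLt _) hi hj
      h₁ h₂ h₃ hlost ?_
    exact (kingAdj_comm _ _).trans hlost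
  calc (WordsOfLen B 4 ∩ WordsOfLen stdBoard 4).ncard
      ≤ ((L.map word).toFinset : Set (List (Fin 9))).ncard :=
        Set.ncard_le_ncard hsub (Finset.finite_toSet _)
    _ = (L.map word).toFinset.card := Set.ncard_coe_finset _
    _ ≤ (L.map word).length := List.toFinset_card_le _
    _ ≤ 376 := by rwa [List.length_map]
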